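/- Let G be a finite simple graph with independence number α such that the join G + K_d has i as an independence root for some integer d ≥ 1. Then for all integers k ≥ 0, the graph (G ∪ \overline{K_{8k}}) + K_{16^k d} is connected, has independence number α + 8k, and has independence roots at i and −i. -/

import Mathlib

open scoped Classical
open Polynomial

/-- `s` is an independent set of the simple graph `G`. -/
def SimpleGraph.IsIndepFinset {V : Type} (G : SimpleGraph V) (s : Finset V) : Prop :=
  ∀ u ∈ s, ∀ v ∈ s, ¬ G.Adj u v

/-- The independence polynomial of `G`, as a polynomial over `ℂ`:
`I(G,x) = ∑_k s_k x^k` where `s_k` is the number of independent sets of cardinality `k`. -/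
noncomputable def indepPoly {V : Type} [Fintype V] (G : SimpleGraph V) : Polynomial ℂ :=
  ∑ s ∈ Finset.univ.filter (fun s : Finset V => G.IsIndepFinset s), (X : Polynomial ℂ) ^ s.card

/-- The independence number of `G`. -/
noncomputable def indepNum {V : Type} [Fintype V] (G : SimpleGraph V) : ℕ :=
  (Finset.univ.filter (fun s : Finset V => G.IsIndepFinset s)).sup Finset.card

/-- The join `G + H` of two graphs: their disjoint union together with
all edges between the two parts. -/
def graphJoin {α β : Type} (G : SimpleGraph α) (H : SimpleGraph β) : SimpleGraph (α ⊕ β) where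
  Adj x y :=
    match x, y with
    | Sum.inl a, Sum.inl b => G.Adj a b
    | Sum.inr a, Sum.inr b => H.Adj a b
    | Sum.inl _, Sum.inr _ => True
    | Sum.inr _, Sum.inl _ => True
  symm := by
    refine ⟨?_⟩
    rintro (a | a) (b | b) h
    · exact G.adj_symm h
    · trivial
    · trivial
    · exact H.adj_symm h
  loopless := by
    refine ⟨?_⟩
    rintro (a | a) h
    · exact G.loopless.irrefl a h
    · exact H.loopless.irrefl a h

/-- `mK_n` : the disjoint union of `m` copies of the complete graph `K_n`. -/
def mClique (m n : ℕ) : SimpleGraph (Fin m × Fin n) where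
  Adj x y := x.1 = y.1 ∧ x ≠ y
  symm := by refine ⟨?_⟩; rintro x y ⟨h1, h2⟩; exact ⟨h1.symm, h2.symm⟩
  loopless := by refine ⟨?_⟩; rintro x ⟨_, h⟩; exact h rfl

/-- The lexicographic product `G[H]`. -/
def lexProd {α β : Type} (G : SimpleGraph α) (H : SimpleGraph β) : SimpleGraph (α × β) where
  Adj x y := G.Adj x.1 y.1 ∨ (x.1 = y.1 ∧ H.Adj x.2 y.2)
  symm := by
    refine ⟨?_⟩
    rintro x y (h | ⟨h1, h2⟩)
    · exact Or.inl (G.adj_symm h)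
    · exact Or.inr ⟨h1.symm, H.adj_symm h2⟩
  loopless := by
    refine ⟨?_⟩
    rintro x (h | ⟨-, h⟩)
    · exact G.loopless.irrefl _ h
    · exact H.loopless.irrefl _ h

/-- The corona `G ∘ H`: for each vertex `v` of `G`, add a new copy of `H`
joined completely to `v`. -/
def corona {α β : Type} (G : SimpleGraph α) (H : SimpleGraph β) : SimpleGraph (α ⊕ α × β) where
  Adj x y :=
    match x, y with
    | Sum.inl a, Sum.inl b => G.Adj a b
    | Sum.inl a, Sum.inr b => a = b.1
    | Sum.inr a, Sum.inl b => b = a.1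
    | Sum.inr a, Sum.inr b => a.1 = b.1 ∧ H.Adj a.2 b.2
  symm := by
    refine ⟨?_⟩
    rintro (a | a) (b | b) h
    · exact G.adj_symm h
    · exact h
    · exact h
    · exact ⟨h.1.symm, H.adj_symm h.2⟩
  loopless := by
    refine ⟨?_⟩
    rintro (a | a) h
    · exact G.loopless.irrefl a h
    · exact H.loopless.irrefl a.2 h.2

theorem isIndepFinset_empty {V : Type} (G : SimpleGraph V) : G.IsIndepFinset ∅ := by
  simp [SimpleGraph.IsIndepFinset]

theorem isIndepFinset_sum_disjSum {α β : Type} (G : SimpleGraph α) (H : SimpleGraph β)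
    (s : Finset α) (t : Finset β) :
    (G ⊕g H).IsIndepFinset (s.disjSum t) ↔ G.IsIndepFinset s ∧ H.IsIndepFinset t := by
  simp [SimpleGraph.IsIndepFinset]

theorem isIndepFinset_graphJoin_disjSum {α β : Type} (G : SimpleGraph α) (H : SimpleGraph β)
    (s : Finset α) (t : Finset β) :
    (graphJoin G H).IsIndepFinset (s.disjSum t) ↔
      G.IsIndepFinset s ∧ H.IsIndepFinset t ∧ (s = ∅ ∨ t = ∅) := by
  have key : (s = ∅ ∨ t = ∅) ↔ ∀ u ∈ s, ∀ v ∈ t, False := by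
    simp only [Finset.eq_empty_iff_forall_notMem]
    grind
  rw [key]
  simp only [SimpleGraph.IsIndepFinset, graphJoin, Sum.forall, Finset.inl_mem_disjSum,
    Finset.inr_mem_disjSum]
  grind

theorem exists_disjSum_eq {α β : Type} (s : Finset (α ⊕ β)) :
    ∃ (a : Finset α) (b : Finset β), a.disjSum b = s :=
  ⟨s.toLeft, s.toRight, Finset.toLeft_disjSum_toRight⟩

theorem indepPoly_eq_sum_ite {V : Type} [Fintype V] (G : SimpleGraph V) :
    indepPoly G = ∑ s : Finset V, if G.IsIndepFinset s then (X : ℂ[X]) ^ s.card else 0 := by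
  rw [indepPoly, Finset.sum_filter]

theorem indepPoly_eq_sum_disjSum {α β : Type} [Fintype α] [Fintype β]
    (G : SimpleGraph (α ⊕ β)) :
    indepPoly G = ∑ s : Finset α, ∑ t : Finset β,
      if G.IsIndepFinset (s.disjSum t) then (X : ℂ[X]) ^ (s.card + t.card) else 0 := by
  rw [indepPoly_eq_sum_ite, ← Fintype.sum_prod_type',
    ← Finset.sumEquiv.symm.toEquiv.sum_comp]
  refine Finset.sum_congr rfl fun p _ => ?_
  simp [Finset.sumEquiv]

/-- The independence polynomial is multiplicative on disjoint unions. -/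
theorem indepPoly_sum {α β : Type} [Fintype α] [Fintype β]
    (G : SimpleGraph α) (H : SimpleGraph β) :
    indepPoly (G ⊕g H) = indepPoly G * indepPoly H := by
  rw [indepPoly_eq_sum_disjSum, indepPoly_eq_sum_ite G, indepPoly_eq_sum_ite H,
    Finset.sum_mul_sum]
  refine Finset.sum_congr rfl fun s _ => Finset.sum_congr rfl fun t _ => ?_
  rw [isIndepFinset_sum_disjSum, pow_add]
  split_ifs <;> simp_all

/-- The independence polynomial of a join. -/
theorem indepPoly_graphJoin {α β : Type} [Fintype α] [Fintype β]
    (G : SimpleGraph α) (H : SimpleGraph β) :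
    indepPoly (graphJoin G H) = indepPoly G + indepPoly H - 1 := by
  have key : ∀ (s : Finset α) (t : Finset β),
      (if (graphJoin G H).IsIndepFinset (s.disjSum t) then
        (X : ℂ[X]) ^ (s.card + t.card) else 0) =
      (if t = ∅ then (if G.IsIndepFinset s then (X : ℂ[X]) ^ s.card else 0) else 0) +
      (if s = ∅ then (if H.IsIndepFinset t then (X : ℂ[X]) ^ t.card else 0) else 0) -
      (if t = ∅ then (if s = ∅ then 1 else 0) else 0) := by
    intro s t
    rw [isIndepFinset_graphJoin_disjSum]
    by_cases hs : s = ∅ <;> by_cases ht : t = ∅ <;>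
      simp [hs, ht, isIndepFinset_empty]
  rw [indepPoly_eq_sum_disjSum, indepPoly_eq_sum_ite G, indepPoly_eq_sum_ite H]
  simp_rw [key, Finset.sum_sub_distrib, Finset.sum_add_distrib]
  congr 1
  · congr 1
    · simp
    · rw [Finset.sum_comm]
      simp
  · simp

theorem isIndepFinset_completeGraph {V : Type} (s : Finset V) :
    (SimpleGraph.completeGraph V).IsIndepFinset s ↔ s.card ≤ 1 := by
  simp [SimpleGraph.IsIndepFinset, Finset.card_le_one]

theorem indepPoly_completeGraph {V : Type} [Fintype V] :
    indepPoly (SimpleGraph.completeGraph V) = 1 + (Fintype.card V : ℂ[X]) * X := by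
  have hf : Finset.univ.filter
      (fun s : Finset V => (SimpleGraph.completeGraph V).IsIndepFinset s) =
      insert ∅ (Finset.univ.map ⟨fun v : V => ({v} : Finset V), Finset.singleton_injective⟩) := by
    ext s
    simp [isIndepFinset_completeGraph, Nat.le_one_iff_eq_zero_or_eq_one, Finset.card_eq_one,
      eq_comm]
  rw [indepPoly, hf, Finset.sum_insert (by simp), Finset.sum_map]
  simp

theorem indepPoly_emptyGraph {V : Type} [Fintype V] :
    indepPoly (SimpleGraph.emptyGraph V) = (1 + X) ^ Fintype.card V := by
  rw [indepPoly_eq_sum_ite, add_comm, ← Fintype.sum_pow_mul_eq_add_pow]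
  simp [SimpleGraph.IsIndepFinset]

theorem SimpleGraph.IsIndepFinset.card_le {V : Type} [Fintype V] {G : SimpleGraph V}
    {s : Finset V} (hs : G.IsIndepFinset s) : s.card ≤ _root_.indepNum G :=
  Finset.le_sup (f := Finset.card) (by simpa using hs)

theorem exists_isIndepFinset_card_eq_indepNum {V : Type} [Fintype V] (G : SimpleGraph V) :
    ∃ s, G.IsIndepFinset s ∧ s.card = indepNum G := by
  obtain ⟨s, hs, h⟩ := Finset.exists_mem_eq_sup
    (Finset.univ.filter (fun s : Finset V => G.IsIndepFinset s))
    ⟨∅, by simpa using isIndepFinset_empty G⟩ Finset.card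
  exact ⟨s, by simpa using hs, h.symm⟩

theorem indepNum_le {V : Type} [Fintype V] {G : SimpleGraph V} {n : ℕ}
    (h : ∀ s, G.IsIndepFinset s → s.card ≤ n) : indepNum G ≤ n :=
  Finset.sup_le fun s hs => h s (by simpa using hs)

theorem indepNum_sum {α β : Type} [Fintype α] [Fintype β]
    (G : SimpleGraph α) (H : SimpleGraph β) :
    indepNum (G ⊕g H) = indepNum G + indepNum H := by
  apply le_antisymm
  · refine indepNum_le fun u hu => ?_
    obtain ⟨s, t, rfl⟩ := exists_disjSum_eq u
    obtain ⟨hs, ht⟩ := (isIndepFinset_sum_disjSum G H s t).1 hu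
    rw [Finset.card_disjSum]
    exact add_le_add hs.card_le ht.card_le
  · obtain ⟨s, hs, hs'⟩ := exists_isIndepFinset_card_eq_indepNum G
    obtain ⟨t, ht, ht'⟩ := exists_isIndepFinset_card_eq_indepNum H
    rw [← hs', ← ht', ← Finset.card_disjSum]
    exact ((isIndepFinset_sum_disjSum G H s t).2 ⟨hs, ht⟩).card_le

theorem indepNum_graphJoin {α β : Type} [Fintype α] [Fintype β]
    (G : SimpleGraph α) (H : SimpleGraph β) :
    indepNum (graphJoin G H) = max (indepNum G) (indepNum H) := by
  apply le_antisymm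
  · refine indepNum_le fun u hu => ?_
    obtain ⟨s, t, rfl⟩ := exists_disjSum_eq u
    rw [isIndepFinset_graphJoin_disjSum] at hu
    obtain ⟨hs, ht, rfl | rfl⟩ := hu
    · simpa using Or.inr ht.card_le
    · simpa using Or.inl hs.card_le
  · obtain ⟨s, hs, hs'⟩ := exists_isIndepFinset_card_eq_indepNum G
    obtain ⟨t, ht, ht'⟩ := exists_isIndepFinset_card_eq_indepNum H
    rw [← hs', ← ht']
    refine max_le ?_ ?_
    · simpa using ((isIndepFinset_graphJoin_disjSum G H s ∅).2
        ⟨hs, isIndepFinset_empty H, Or.inr rfl⟩).card_le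
    · simpa using ((isIndepFinset_graphJoin_disjSum G H ∅ t).2
        ⟨isIndepFinset_empty G, ht, Or.inl rfl⟩).card_le

theorem indepNum_completeGraph_le_one {V : Type} [Fintype V] :
    indepNum (SimpleGraph.completeGraph V) ≤ 1 :=
  indepNum_le fun s hs => (isIndepFinset_completeGraph s).1 hs

theorem indepNum_emptyGraph {V : Type} [Fintype V] :
    indepNum (SimpleGraph.emptyGraph V) = Fintype.card V :=
  le_antisymm (indepNum_le fun s _ => Finset.card_le_univ s)
    (SimpleGraph.IsIndepFinset.card_le (s := Finset.univ) (by simp [SimpleGraph.IsIndepFinset]))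

theorem one_le_indepNum {V : Type} [Fintype V] [Nonempty V] (G : SimpleGraph V) :
    1 ≤ indepNum G := by
  obtain ⟨v⟩ := ‹Nonempty V›
  simpa using (show G.IsIndepFinset {v} by simp [SimpleGraph.IsIndepFinset]).card_le

theorem graphJoin_connected {α β : Type} [Nonempty α] [Nonempty β]
    (G : SimpleGraph α) (H : SimpleGraph β) : (graphJoin G H).Connected := by
  obtain ⟨a⟩ := ‹Nonempty α›
  obtain ⟨b⟩ := ‹Nonempty β›
  have hl : ∀ x, (graphJoin G H).Reachable (Sum.inl x) (Sum.inr b) := fun x =>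
    SimpleGraph.Adj.reachable (G := graphJoin G H) trivial
  have hr : ∀ y, (graphJoin G H).Reachable (Sum.inr y) (Sum.inl a) := fun y =>
    SimpleGraph.Adj.reachable (G := graphJoin G H) trivial
  have hb : ∀ z, (graphJoin G H).Reachable z (Sum.inr b) := by
    rintro (x | y)
    · exact hl x
    · exact (hr y).trans (hl a)
  have : Nonempty (α ⊕ β) := ⟨Sum.inl a⟩
  exact ⟨fun x y => (hb x).trans (hb y).symm⟩

/-- Evaluating an independence polynomial commutes with complex conjugation. -/
theorem indepPoly_eval_conj {V : Type} [Fintype V] (G : SimpleGraph V) (z : ℂ) :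
    (indepPoly G).eval (starRingEnd ℂ z) = starRingEnd ℂ ((indepPoly G).eval z) := by
  simp [indepPoly, eval_finsetSum]

theorem one_add_I_pow_eight_mul (k : ℕ) : (1 + Complex.I) ^ (8 * k) = 16 ^ k := by
  have h2 : (1 + Complex.I) ^ 2 = 2 * Complex.I := by
    linear_combination Complex.I_sq
  have h8 : (1 + Complex.I) ^ 8 = 16 := by
    rw [show 8 = 2 * 4 from rfl, pow_mul, h2, mul_pow, Complex.I_pow_four]
    norm_num
  rw [pow_mul, h8]

/-- If `G + K_d` has an independence root at `i` for some `d ≥ 1`, then for every `k ≥ 0` the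
graph `(G ∪ K̄₈ₖ) + K_{16ᵏd}` is connected, has independence number `α(G) + 8k`, and has
independence roots at `i` and `−i`. -/
theorem join_union_empty_has_root_I {V : Type} [Fintype V] (G : SimpleGraph V) (d : ℕ)
    (hd : 1 ≤ d)
    (h : (indepPoly (graphJoin G (SimpleGraph.completeGraph (Fin d)))).eval Complex.I = 0) :
    ∀ k : ℕ,
      (graphJoin (G ⊕g SimpleGraph.emptyGraph (Fin (8 * k)))
        (SimpleGraph.completeGraph (Fin (16 ^ k * d)))).Connected ∧
      indepNum (graphJoin (G ⊕g SimpleGraph.emptyGraph (Fin (8 * k)))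
        (SimpleGraph.completeGraph (Fin (16 ^ k * d)))) = indepNum G + 8 * k ∧
      (indepPoly (graphJoin (G ⊕g SimpleGraph.emptyGraph (Fin (8 * k)))
        (SimpleGraph.completeGraph (Fin (16 ^ k * d))))).eval Complex.I = 0 ∧
      (indepPoly (graphJoin (G ⊕g SimpleGraph.emptyGraph (Fin (8 * k)))
        (SimpleGraph.completeGraph (Fin (16 ^ k * d))))).eval (-Complex.I) = 0 := by
  intro k
  have hG : (indepPoly G).eval Complex.I = -(d * Complex.I) := by
    rw [indepPoly_graphJoin, indepPoly_completeGraph] at h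
    simp only [eval_sub, eval_add, eval_one, eval_mul, eval_X, eval_natCast,
      Fintype.card_fin] at h
    linear_combination h
  have hV : Nonempty V := by
    by_contra hV
    rw [not_nonempty_iff] at hV
    have hone : indepPoly G = 1 := by
      simp [indepPoly_eq_sum_ite, Subsingleton.elim default (∅ : Finset V),
        isIndepFinset_empty]
    rw [hone] at hG
    simpa using congrArg Complex.re hG
  have : Nonempty (Fin (16 ^ k * d)) := ⟨⟨0, by positivity⟩⟩
  have hI : (indepPoly (graphJoin (G ⊕g SimpleGraph.emptyGraph (Fin (8 * k)))
      (SimpleGraph.completeGraph (Fin (16 ^ k * d))))).eval Complex.I = 0 := by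
    rw [indepPoly_graphJoin, indepPoly_sum, indepPoly_completeGraph, indepPoly_emptyGraph]
    simp only [eval_sub, eval_add, eval_one, eval_mul, eval_X, eval_natCast, eval_pow,
      Fintype.card_fin, hG, one_add_I_pow_eight_mul]
    push_cast
    ring
  refine ⟨graphJoin_connected _ _, ?_, hI, ?_⟩
  · rw [indepNum_graphJoin, indepNum_sum, indepNum_emptyGraph, Fintype.card_fin]
    exact max_eq_left (indepNum_completeGraph_le_one.trans
      ((one_le_indepNum G).trans (Nat.le_add_right _ _)))
  · rw [← Complex.conj_I, indepPoly_eval_conj, hI, map_zero]
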